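/- Let N = 2, let q ∈ ℂ* be not a root of unity (or q = 1), and let ξ = diag(ξ₁, ξ₂). If ξ₁ − q^{2k} ξ₂ ≠ 0 for all k = 0, 1, 2, …, then the kernel of the co-orbit map β^ξ equals the right ideal (τ₁ − τ₁(ξ))·O(M_q) + (τ₂ − τ₂(ξ))·O(M_q), where τ₁ = q^{-2}x_{11} + q^{-4}x_{22} and τ₂ = det_q. -/

import Mathlib

open TensorProduct

noncomputable section

/-- Number of inversions (the length) of a permutation of `Fin t`. -/
def invCount {t : ℕ} (σ : Equiv.Perm (Fin t)) : ℕ :=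
  (Finset.univ.filter fun p : Fin t × Fin t => p.1 < p.2 ∧ σ p.2 < σ p.1).card

/-- The principal quantum minor `[I|I]` of the matrix of generators `x`. -/
def qMinor {A : Type} [CommRing A] {M : Type} [Ring M] [Algebra A M] {N : ℕ}
    (q : A) (x : Fin N → Fin N → M) (I : Finset (Fin N)) : M :=
  ∑ σ : Equiv.Perm (Fin I.card),
    ((-q) ^ invCount σ) •
      ((List.finRange I.card).map fun k =>
        x ((I.orderIsoOfFin rfl) k).1 ((I.orderIsoOfFin rfl) (σ k)).1).prod

/-- The quantum determinant. -/
def qdet {A : Type} [CommRing A] {M : Type} [Ring M] [Algebra A M] {N : ℕ}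
    (q : A) (x : Fin N → Fin N → M) : M :=
  qMinor q x Finset.univ

/-- `w(I)`: the sum of the elements of `I` (with `{1, …, N}` indexing). -/
def wtSet {N : ℕ} (I : Finset (Fin N)) : ℕ := ∑ j ∈ I, (j.1 + 1)

/-- The weighted sum `τ_i` of principal quantum minors of size `i`. -/
def tauCoinv {A : Type} [CommRing A] {M : Type} [Ring M] [Algebra A M] {N : ℕ}
    (q qinv : A) (x : Fin N → Fin N → M) (i : ℕ) : M :=
  ∑ I ∈ Finset.univ.filter (fun I : Finset (Fin N) => I.card = i),
    qinv ^ (2 * wtSet I) • qMinor q x I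

/-- The sum `σ_i` of all principal quantum minors of size `i`. -/
def sigmaCoinv {A : Type} [CommRing A] {M : Type} [Ring M] [Algebra A M] {N : ℕ}
    (q : A) (x : Fin N → Fin N → M) (i : ℕ) : M :=
  ∑ I ∈ Finset.univ.filter (fun I : Finset (Fin N) => I.card = i), qMinor q x I

/-- The right adjoint coaction `β(h) = Σ h₂ ⊗ S(h₁)h₃`. -/
def adjBeta {A : Type} [CommRing A] {M G : Type} [Ring M] [Algebra A M] [Ring G] [Algebra A G]
    (ΔM : M →ₐ[A] M ⊗[A] M) (ι : M →ₐ[A] G) (St : G →ₗ[A] G) : M →ₗ[A] M ⊗[A] G :=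
  TensorProduct.map LinearMap.id (LinearMap.mul' A G) ∘ₗ
  (TensorProduct.assoc A M G G).toLinearMap ∘ₗ
  TensorProduct.map
    ((TensorProduct.comm A G M).toLinearMap ∘ₗ
      TensorProduct.map (St ∘ₗ ι.toLinearMap) LinearMap.id)
    ι.toLinearMap ∘ₗ
  TensorProduct.map ΔM.toLinearMap LinearMap.id ∘ₗ ΔM.toLinearMap

/-- The right coaction `α(h) = Σ h₂ ⊗ h₃S(h₁)`. -/
def adjAlpha {A : Type} [CommRing A] {M G : Type} [Ring M] [Algebra A M] [Ring G] [Algebra A G]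
    (ΔM : M →ₐ[A] M ⊗[A] M) (ι : M →ₐ[A] G) (St : G →ₗ[A] G) : M →ₗ[A] M ⊗[A] G :=
  TensorProduct.map LinearMap.id (LinearMap.mul' A G) ∘ₗ
  TensorProduct.map LinearMap.id (TensorProduct.comm A G G).toLinearMap ∘ₗ
  (TensorProduct.assoc A M G G).toLinearMap ∘ₗ
  TensorProduct.map
    ((TensorProduct.comm A G M).toLinearMap ∘ₗ
      TensorProduct.map (St ∘ₗ ι.toLinearMap) LinearMap.id)
    ι.toLinearMap ∘ₗ
  TensorProduct.map ΔM.toLinearMap LinearMap.id ∘ₗ ΔM.toLinearMap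

/-- The co-orbit map associated to a point `e = ev_ξ` and a coaction `b`. -/
def coorbit {A : Type} [CommRing A] {M G : Type} [Ring M] [Algebra A M] [Ring G] [Algebra A G]
    (e : M →ₐ[A] A) (b : M →ₗ[A] M ⊗[A] G) : M →ₗ[A] G :=
  (TensorProduct.lid A G).toLinearMap ∘ₗ TensorProduct.map e.toLinearMap LinearMap.id ∘ₗ b

/-- The left coaction `λ_D = (π_D ⊗ id) ∘ Δ` of a quotient Hopf algebra. -/
def leftCoact {A : Type} [CommRing A] {G D : Type} [Ring G] [Algebra A G]
    [CommRing D] [Algebra A D]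
    (πD : G →ₐ[A] D) (ΔG : G →ₐ[A] G ⊗[A] G) : G →ₗ[A] D ⊗[A] G :=
  TensorProduct.map πD.toLinearMap LinearMap.id ∘ₗ ΔG.toLinearMap

/-- Coinvariants of the left coaction `λ_D`. -/
def dCoinv {A : Type} [CommRing A] {G D : Type} [Ring G] [Algebra A G]
    [CommRing D] [Algebra A D]
    (πD : G →ₐ[A] D) (ΔG : G →ₐ[A] G ⊗[A] G) : Set G :=
  {f : G | leftCoact πD ΔG f = (1 : D) ⊗ₜ[A] f}

/-- The right coaction `ρ_D = (id ⊗ π_D) ∘ Δ`. -/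
def rightCoact {A : Type} [CommRing A] {G D : Type} [Ring G] [Algebra A G]
    [CommRing D] [Algebra A D]
    (πD : G →ₐ[A] D) (ΔG : G →ₐ[A] G ⊗[A] G) : G →ₗ[A] G ⊗[A] D :=
  TensorProduct.map LinearMap.id πD.toLinearMap ∘ₗ ΔG.toLinearMap

/-- The weight space of weight `ta : D` for the grading induced by `ρ_D`. -/
def weightSpace' {A : Type} [CommRing A] {G D : Type} [Ring G] [Algebra A G]
    [CommRing D] [Algebra A D]
    (πD : G →ₐ[A] D) (ΔG : G →ₐ[A] G ⊗[A] G) (ta : D) : Submodule A G :=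
  LinearMap.ker (rightCoact πD ΔG - (TensorProduct.mk A G D).flip ta)

/-- The subcomodule generated by a subset `s` of the comodule `(M, b)`. -/
def comodGen {A : Type} [CommRing A] {M G : Type} [Ring M] [Algebra A M] [Ring G] [Algebra A G]
    (b : M →ₗ[A] M ⊗[A] G) (s : Set M) : Submodule A M :=
  sInf {W : Submodule A M | s ⊆ W ∧
    ∀ w ∈ W, b w ∈ LinearMap.range (TensorProduct.map W.subtype (LinearMap.id : G →ₗ[A] G))}

open Polynomial

/-- In a Hopf algebra given by unbundled data, the antipode reverses products. -/
theorem antipode_mul_rev {A G : Type} [CommRing A] [Ring G] [Algebra A G]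
    (Δ : G →ₐ[A] G ⊗[A] G) (ε : G →ₐ[A] A) (S : G →ₗ[A] G)
    (hassoc : (Algebra.TensorProduct.assoc A A A G G G).toAlgHom.comp
      ((Algebra.TensorProduct.map Δ (.id A G)).comp Δ)
      = (Algebra.TensorProduct.map (.id A G) Δ).comp Δ)
    (hl : (Algebra.TensorProduct.map ε (.id A G)).comp Δ = (Algebra.TensorProduct.lid A G).symm)
    (hr : (Algebra.TensorProduct.map (.id A G) ε).comp Δ = (Algebra.TensorProduct.rid A A G).symm)
    (hS1 : LinearMap.mul' A G ∘ₗ TensorProduct.map S LinearMap.id ∘ₗ Δ.toLinearMap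
      = Algebra.linearMap A G ∘ₗ ε.toLinearMap)
    (hS2 : LinearMap.mul' A G ∘ₗ TensorProduct.map LinearMap.id S ∘ₗ Δ.toLinearMap
      = Algebra.linearMap A G ∘ₗ ε.toLinearMap) (u v : G) :
    S (u * v) = S v * S u := by
  let _ : Bialgebra A G := Bialgebra.ofAlgHom Δ ε hassoc hl hr
  let _ : HopfAlgebra A G :=
    { antipode := S
      mul_antipode_rTensor_comul := hS1
      mul_antipode_lTensor_comul := hS2 }
  exact HopfAlgebra.antipode_mul_antidistrib (R := A) u v

/-- Right multiplication by `m` acts on the values of the co-orbit map of `β` through the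
twofold coproduct of `m`; here for an element with matrix coproduct. -/
theorem coorbit_adjBeta_mul {A M G : Type} [CommRing A] [Ring M] [Algebra A M] [Ring G]
    [Algebra A G] {n : Type} [Fintype n] (ΔM : M →ₐ[A] M ⊗[A] M) (ι : M →ₐ[A] G) (S : G →ₗ[A] G)
    (hS : ∀ u v, S (u * v) = S v * S u) (e : M →ₐ[A] A) (x : n → n → M)
    (hΔ : ∀ i j, ΔM (x i j) = ∑ k, x i k ⊗ₜ[A] x k j) (h : M) (i j : n) :
    coorbit e (adjBeta ΔM ι S) (h * x i j) = ∑ k, ∑ l, e (x k l) •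
      (S (ι (x i k)) * coorbit e (adjBeta ΔM ι S) h * ι (x l j)) := by
  set Φ : (M ⊗[A] M) ⊗[A] M →ₗ[A] G :=
    (TensorProduct.lid A G).toLinearMap ∘ₗ TensorProduct.map e.toLinearMap LinearMap.id ∘ₗ
    TensorProduct.map LinearMap.id (LinearMap.mul' A G) ∘ₗ
    (TensorProduct.assoc A M G G).toLinearMap ∘ₗ
    TensorProduct.map
      ((TensorProduct.comm A G M).toLinearMap ∘ₗ
        TensorProduct.map (S ∘ₗ ι.toLinearMap) LinearMap.id) ι.toLinearMap with hΦ
  have hΦt (u v w : M) : Φ ((u ⊗ₜ v) ⊗ₜ w) = e v • (S (ι u) * ι w) := by simp [hΦ]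
  set Δ2 := (Algebra.TensorProduct.map ΔM (AlgHom.id A M)).comp ΔM with hΔ2
  have hco (m : M) : coorbit e (adjBeta ΔM ι S) m = Φ (Δ2 m) := rfl
  have hx : Δ2 (x i j) = ∑ k, ∑ l, (x i k ⊗ₜ[A] x k l) ⊗ₜ[A] x l j := by
    simp only [hΔ2, AlgHom.comp_apply, hΔ, map_sum, Algebra.TensorProduct.map_tmul,
      TensorProduct.sum_tmul, AlgHom.id_apply]
    exact Finset.sum_comm
  have key (t : (M ⊗[A] M) ⊗[A] M) (k l : n) :
      Φ (t * ((x i k ⊗ₜ[A] x k l) ⊗ₜ[A] x l j)) =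
        e (x k l) • (S (ι (x i k)) * Φ t * ι (x l j)) := by
    induction t with
    | zero => simp
    | add s t hs ht => simp only [add_mul, mul_add, map_add, hs, ht, smul_add]
    | tmul s w =>
      induction s with
      | zero => simp
      | add s t hs ht => simp only [TensorProduct.add_tmul, add_mul, mul_add, map_add, hs, ht,
          smul_add]
      | tmul u v =>
        simp only [Algebra.TensorProduct.tmul_mul_tmul, hΦt, map_mul, hS, smul_mul_assoc,
          mul_smul_comm, smul_smul, mul_assoc]
        rw [mul_comm]
  simp only [hco, map_mul, hx, Finset.mul_sum, map_sum, key]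

/-- A subspace containing `1` and stable under right multiplication by algebra generators is
everything. -/
theorem Submodule.eq_top_of_mul_mem {A M : Type*} [CommRing A] [Ring M] [Algebra A M] {s : Set M}
    (hs : Algebra.adjoin A s = ⊤) (W : Submodule A M) (h1 : 1 ∈ W)
    (hW : ∀ w ∈ W, ∀ y ∈ s, w * y ∈ W) : W = ⊤ := by
  have key (m : M) : ∀ w ∈ W, w * m ∈ W := by
    have hm : m ∈ Algebra.adjoin A s := by simp [hs]
    induction hm using Algebra.adjoin_induction with
    | mem y hy => exact fun w hw => hW w hw y hy
    | algebraMap r =>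
      intro w hw
      rw [← Algebra.commutes, ← Algebra.smul_def]
      exact W.smul_mem r hw
    | add y z _ _ hy hz => exact fun w hw => by rw [mul_add]; exact W.add_mem (hy w hw) (hz w hw)
    | mul y z _ _ hy hz => exact fun w hw => by rw [← mul_assoc]; exact hz _ (hy w hw)
  exact eq_top_iff.2 fun m _ => by simpa using key m 1 h1

/-- The relations between the entries of the quantum `2 × 2` matrix `(a, b; c, d)`. -/
structure IsQuantumMatrix (q : ℂ) {R : Type} [Ring R] [Algebra ℂ R] (a b c d : R) : Prop where
  ab : a * b = q • (b * a)
  ac : a * c = q • (c * a)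
  bd : b * d = q • (d * b)
  cd : c * d = q • (d * c)
  bc : b * c = c * b
  ad : a * d = d * a + (q - q⁻¹) • (b * c)

section Powers

variable {R : Type} [Ring R] [Algebra ℂ R]

theorem mul_pow_eq_smul {u v : R} {r : ℂ} (h : u * v = r • (v * u)) (n : ℕ) :
    u * v ^ n = r ^ n • (v ^ n * u) := by
  induction n with
  | zero => simp
  | succ n ih =>
    rw [pow_succ, ← mul_assoc, ih, smul_mul_assoc, mul_assoc, h, mul_smul_comm, smul_smul,
      mul_assoc, ← pow_succ]

theorem pow_mul_eq_smul {u v : R} {r : ℂ} (h : u * v = r • (v * u)) (n : ℕ) :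
    u ^ n * v = r ^ n • (v * u ^ n) := by
  induction n with
  | zero => simp
  | succ n ih =>
    rw [pow_succ', mul_assoc, ih, mul_smul_comm, ← mul_assoc, h, smul_mul_assoc, smul_smul,
      mul_assoc, ← pow_succ]

theorem mul_aeval_eq {u z : R} {r : ℂ} (h : u * z = r • (z * u)) (f : ℂ[X]) :
    u * aeval z f = aeval z (f.comp (C r * X)) * u := by
  induction f using Polynomial.induction_on' with
  | add f g hf hg => simp only [map_add, mul_add, add_comp, add_mul, hf, hg]
  | monomial n s =>
    simp only [← C_mul_X_pow_eq_monomial, map_mul, aeval_C, map_pow, aeval_X, mul_comp, C_comp,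
      pow_comp, X_comp, mul_pow]
    rw [← Algebra.smul_def, mul_smul_comm, mul_pow_eq_smul h, ← map_pow, ← Algebra.smul_def,
      ← Algebra.smul_def, smul_mul_assoc, smul_mul_assoc]

end Powers

namespace IsQuantumMatrix

variable {q : ℂ} {R : Type} [Ring R] [Algebra ℂ R] {a b c d : R}

theorem swap (h : IsQuantumMatrix q a b c d) : IsQuantumMatrix q a c b d :=
  ⟨h.ac, h.ab, h.cd, h.bd, h.bc.symm, by rw [h.ad, h.bc]⟩

/-- The quantum determinant is symmetric under transposition of the matrix. -/
theorem det_swap (h : IsQuantumMatrix q a b c d) :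
    a * d - q • (c * b) = a * d - q • (b * c) := by rw [h.bc]

theorem map {S : Type} [Ring S] [Algebra ℂ S] (h : IsQuantumMatrix q a b c d) (f : R →ₐ[ℂ] S) :
    IsQuantumMatrix q (f a) (f b) (f c) (f d) := by
  constructor <;> simp only [← map_mul, ← map_smul, ← map_add, h.ab, h.ac, h.bd, h.cd, h.bc, h.ad]

theorem ba (h : IsQuantumMatrix q a b c d) (hq : q ≠ 0) : b * a = q⁻¹ • (a * b) := by
  rw [h.ab, inv_smul_smul₀ hq]

theorem db (h : IsQuantumMatrix q a b c d) (hq : q ≠ 0) : d * b = q⁻¹ • (b * d) := by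
  rw [h.bd, inv_smul_smul₀ hq]

theorem ca (h : IsQuantumMatrix q a b c d) (hq : q ≠ 0) : c * a = q⁻¹ • (a * c) :=
  h.swap.ba hq

theorem dc (h : IsQuantumMatrix q a b c d) (hq : q ≠ 0) : d * c = q⁻¹ • (c * d) :=
  h.swap.db hq

theorem a_bc (h : IsQuantumMatrix q a b c d) : a * (b * c) = q ^ 2 • (b * c * a) := by
  rw [← mul_assoc, h.ab, smul_mul_assoc, mul_assoc, h.ac, mul_smul_comm, smul_smul, mul_assoc, sq]

theorem bc_d (h : IsQuantumMatrix q a b c d) : b * c * d = q ^ 2 • (d * (b * c)) := by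
  rw [mul_assoc, h.cd, mul_smul_comm, ← mul_assoc, h.bd, smul_mul_assoc, smul_smul, mul_assoc, sq]

theorem d_bc (h : IsQuantumMatrix q a b c d) (hq : q ≠ 0) :
    d * (b * c) = (q ^ 2)⁻¹ • (b * c * d) := by
  rw [h.bc_d, inv_smul_smul₀ (pow_ne_zero 2 hq)]

theorem da_eq (h : IsQuantumMatrix q a b c d) :
    d * a = (a * d - q • (b * c)) + q⁻¹ • (b * c) := by
  rw [h.ad, sub_smul]; abel

theorem det_a (h : IsQuantumMatrix q a b c d) (hq : q ≠ 0) :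
    (a * d - q • (b * c)) * a = a * (a * d - q • (b * c)) := by
  have h1 : a * d - q • (b * c) = d * a - q⁻¹ • (b * c) := by rw [h.da_eq]; abel
  conv_rhs => rw [h1]
  rw [sub_mul, mul_sub, mul_smul_comm, h.a_bc, smul_mul_assoc, mul_assoc, smul_smul]
  congr 2
  field_simp

theorem det_b (h : IsQuantumMatrix q a b c d) (hq : q ≠ 0) :
    (a * d - q • (b * c)) * b = b * (a * d - q • (b * c)) := by
  rw [sub_mul, mul_sub, mul_smul_comm, smul_mul_assoc, mul_assoc b c b, ← h.bc, mul_assoc a,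
    h.db hq, mul_smul_comm, ← mul_assoc, h.ab, smul_mul_assoc, inv_smul_smul₀ hq, mul_assoc]

theorem det_c (h : IsQuantumMatrix q a b c d) (hq : q ≠ 0) :
    (a * d - q • (b * c)) * c = c * (a * d - q • (b * c)) := by
  have := h.swap.det_b hq
  rwa [h.det_swap] at this

theorem det_d (h : IsQuantumMatrix q a b c d) (hq : q ≠ 0) :
    (a * d - q • (b * c)) * d = d * (a * d - q • (b * c)) := by
  have h1 : a * d - q • (b * c) = d * a - q⁻¹ • (b * c) := by rw [h.da_eq]; abel
  conv_lhs => rw [h1]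
  rw [sub_mul, mul_sub, mul_smul_comm, smul_mul_assoc, h.bc_d, smul_smul, mul_assoc]
  congr 2
  field_simp

/-- Modulo the quantum determinant, `d` can be moved to the left of a power of `a`. -/
theorem a_pow_d (h : IsQuantumMatrix q a b c d) (hq : q ≠ 0) (k : ℕ) :
    a ^ (k + 1) * d = q ^ (2 * (k + 1)) • (d * a ^ (k + 1)) +
      (1 - q ^ (2 * (k + 1))) • ((a * d - q • (b * c)) * a ^ k) := by
  have h0 : a * d = q ^ 2 • (d * a) + (1 - q ^ 2) • (a * d - q • (b * c)) := by
    rw [h.da_eq, smul_add, sub_smul, smul_smul]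
    have : q ^ 2 * q⁻¹ = q := by field_simp
    rw [this, one_smul]; abel
  induction k with
  | zero => simpa using h0
  | succ k ih =>
    have hD := h.det_a hq
    set D := a * d - q • (b * c)
    rw [pow_succ' a (k + 1), mul_assoc, ih, mul_add, mul_smul_comm, mul_smul_comm, ← mul_assoc a d,
      h0, ← mul_assoc a D, ← hD, mul_assoc D, ← pow_succ', add_mul, smul_mul_assoc, smul_mul_assoc,
      mul_assoc d, smul_add, smul_smul, smul_smul, add_assoc, ← add_smul]
    congr 2 <;> ring

end IsQuantumMatrix

/-- `b ^ n` for `n ≥ 0` and `c ^ (-n)` for `n < 0`. -/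
def signedPow {R : Type} [Ring R] (b c : R) : ℤ → R
  | .ofNat n => b ^ n
  | .negSucc n => c ^ (n + 1)

namespace IsQuantumMatrix

variable {q : ℂ} {R : Type} [Ring R] [Algebra ℂ R] {a b c d : R}

section Spanning

variable {t s : ℂ} {J W : Submodule ℂ R}

theorem a_pow_mul_d_mul_mem (h : IsQuantumMatrix q a b c d) (hq : q ≠ 0)
    (hT : ∀ m, d * m + q ^ 2 • (a * m) - t • m ∈ J)
    (hD : ∀ m, (a * d - q • (b * c)) * m - s • m ∈ J) (hJW : J ≤ W)
    (hW : ∀ k n : ℕ, a ^ k * b ^ n ∈ W) (k n : ℕ) : a ^ k * d * b ^ n ∈ W := by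
  have hd (k : ℕ) : d * a ^ k * b ^ n ∈ W := by
    have h1 := W.add_mem (W.sub_mem (hJW (hT (a ^ k * b ^ n))) (W.smul_mem (q ^ 2) (hW (k + 1) n)))
      (W.smul_mem t (hW k n))
    convert h1 using 1
    rw [pow_succ' a k, mul_assoc, mul_assoc a]
    abel
  have hdet (k : ℕ) : (a * d - q • (b * c)) * a ^ k * b ^ n ∈ W := by
    have h1 := W.add_mem (hJW (hD (a ^ k * b ^ n))) (W.smul_mem s (hW k n))
    rwa [sub_add_cancel, ← mul_assoc] at h1
  cases k with
  | zero => simpa using hd 0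
  | succ k =>
    rw [h.a_pow_d hq, add_mul, smul_mul_assoc, smul_mul_assoc]
    exact W.add_mem (W.smul_mem _ (hd _)) (W.smul_mem _ (hdet _))

theorem a_pow_mul_b_pow_mul_mem (h : IsQuantumMatrix q a b c d) (hq : q ≠ 0)
    (hT : ∀ m, d * m + q ^ 2 • (a * m) - t • m ∈ J)
    (hD : ∀ m, (a * d - q • (b * c)) * m - s • m ∈ J) (hJW : J ≤ W)
    (hWb : ∀ k n : ℕ, a ^ k * b ^ n ∈ W) (hWc : ∀ k n : ℕ, a ^ k * c ^ n ∈ W) (k n : ℕ) :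
    a ^ k * b ^ n * a ∈ W ∧ a ^ k * b ^ n * b ∈ W ∧ a ^ k * b ^ n * c ∈ W ∧
      a ^ k * b ^ n * d ∈ W := by
  have hmem := h.a_pow_mul_d_mul_mem hq hT hD hJW hWb
  have hab : b ^ n * a = (q ^ n)⁻¹ • (a * b ^ n) := by
    rw [mul_pow_eq_smul h.ab, inv_smul_smul₀ (pow_ne_zero n hq)]
  have hdb : b ^ n * d = ((q⁻¹) ^ n)⁻¹ • (d * b ^ n) := by
    rw [mul_pow_eq_smul (h.db hq), inv_smul_smul₀ (pow_ne_zero n (inv_ne_zero hq))]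
  refine ⟨?_, ?_, ?_, ?_⟩
  · rw [mul_assoc, hab, mul_smul_comm, ← mul_assoc, ← pow_succ]
    exact W.smul_mem _ (hWb _ _)
  · rw [mul_assoc, ← pow_succ]
    exact hWb _ _
  · cases n with
    | zero => simpa using hWc k 1
    | succ n =>
      have hbc : b * c = q⁻¹ • (a * d) - q⁻¹ • (a * d - q • (b * c)) := by
        rw [smul_sub, inv_smul_smul₀ hq]; abel
      have hcomm : b ^ n * c = c * b ^ n := (Commute.pow_left h.bc n).eq
      have hdet : a ^ k * (a * d - q • (b * c)) * b ^ n ∈ W := by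
        have hc : Commute (a ^ k) (a * d - q • (b * c)) := Commute.pow_left (h.det_a hq).symm k
        have h1 := W.add_mem (hJW (hD (a ^ k * b ^ n))) (W.smul_mem s (hWb k n))
        rwa [sub_add_cancel, ← mul_assoc, ← hc.eq] at h1
      have h1 := W.sub_mem (W.smul_mem q⁻¹ (hmem (k + 1) n)) (W.smul_mem q⁻¹ hdet)
      convert h1 using 1
      rw [pow_succ', mul_assoc, mul_assoc, hcomm, ← mul_assoc b]
      conv_lhs => rw [hbc]
      simp only [mul_sub, sub_mul, smul_mul_assoc, mul_smul_comm, pow_succ, mul_assoc]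
  · rw [mul_assoc, hdb, mul_smul_comm, ← mul_assoc]
    exact W.smul_mem _ (hmem _ _)

/-- If `J` is a right ideal modulo which left multiplication by the two basic coinvariants is
scalar, then the elements `a ^ k * b ^ n` and `a ^ k * c ^ n` span modulo `J`. -/
theorem sup_span_eq_top (h : IsQuantumMatrix q a b c d) (hq : q ≠ 0)
    (hgen : Algebra.adjoin ℂ {a, b, c, d} = ⊤) (hJ : ∀ j ∈ J, ∀ m, j * m ∈ J)
    (hT : ∀ m, d * m + q ^ 2 • (a * m) - t • m ∈ J)
    (hD : ∀ m, (a * d - q • (b * c)) * m - s • m ∈ J) :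
    J ⊔ Submodule.span ℂ
      (Set.range fun p : (Σ _ : ℤ, ℕ) => a ^ p.2 * signedPow b c p.1) = ⊤ := by
  set W := J ⊔ Submodule.span ℂ
      (Set.range fun p : (Σ _ : ℤ, ℕ) => a ^ p.2 * signedPow b c p.1) with hW
  have hJW : J ≤ W := le_sup_left
  have hu (n : ℤ) (k : ℕ) : a ^ k * signedPow b c n ∈ W :=
    le_sup_right (a := J) (Submodule.subset_span ⟨⟨n, k⟩, rfl⟩)
  have hWb (k n : ℕ) : a ^ k * b ^ n ∈ W := hu n k
  have hWc (k n : ℕ) : a ^ k * c ^ n ∈ W := by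
    cases n with
    | zero => simpa using hWb k 0
    | succ n => exact hu (Int.negSucc n) k
  have hb := h.a_pow_mul_b_pow_mul_mem hq hT hD hJW hWb hWc
  have hc := h.swap.a_pow_mul_b_pow_mul_mem hq hT (by simpa only [h.bc] using hD) hJW hWc hWb
  refine Submodule.eq_top_of_mul_mem hgen W (by simpa using hWb 0 0) fun w hw y hy => ?_
  suffices hle : W ≤ W.comap (LinearMap.mulRight ℂ y) from hle hw
  conv_lhs => rw [hW]
  refine sup_le (fun j hj => hJW (hJ j hj y)) (Submodule.span_le.2 ?_)
  rintro _ ⟨⟨n, k⟩, rfl⟩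
  change a ^ k * signedPow b c n * y ∈ W
  cases n with
  | ofNat n =>
    obtain ⟨h1, h2, h3, h4⟩ := hb k n
    rcases hy with rfl | rfl | rfl | rfl <;> assumption
  | negSucc n =>
    obtain ⟨h1, h2, h3, h4⟩ := hc k (n + 1)
    rcases hy with rfl | rfl | rfl | rfl <;> assumption

end Spanning

end IsQuantumMatrix

section Representation

/-- The action of `a` in a faithful enough representation of quantum `SL₂`: a `q`-dilation of the
variable, lowering the degree. -/
def repA (q : ℂ) : Module.End ℂ (ℤ → ℂ[X]) where
  toFun F n := aeval (C q * X) (F (n + 1))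
  map_add' F F' := by ext1 n; simp
  map_smul' r F := by ext1 n; simp

/-- The action of `b` and of `c`: multiplication by the variable. -/
def repX : Module.End ℂ (ℤ → ℂ[X]) where
  toFun F n := X * F n
  map_add' F F' := by ext1 n; simp [mul_add]
  map_smul' r F := by ext1 n; simp

/-- The action of `d`. -/
def repD (q : ℂ) : Module.End ℂ (ℤ → ℂ[X]) where
  toFun F n := (1 + C q⁻¹ * X ^ 2) * aeval (C q⁻¹ * X) (F (n - 1))
  map_add' F F' := by ext1 n; simp [mul_add]
  map_smul' r F := by ext1 n; simp

theorem aeval_C_mul_X_aeval_C_mul_X {r s : ℂ} (h : r * s = 1) (f : ℂ[X]) :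
    aeval (C r * X) (aeval (C s * X) f) = f := by
  have : (aeval (C r * X)).comp (aeval (C s * X)) = AlgHom.id ℂ ℂ[X] := by
    ext1
    simp [← mul_assoc, ← C_mul, mul_comm s r, h, Polynomial.algebraMap_eq]
  exact DFunLike.congr_fun this f

theorem repA_mul_repD {q : ℂ} (hq : q ≠ 0) : repA q * repD q = 1 + q • (repX * repX) := by
  ext1 F; ext1 n
  have h1 : C q⁻¹ * (C q * X) ^ 2 = C q * (X ^ 2 : ℂ[X]) := by
    rw [mul_pow, ← mul_assoc, ← C_pow, ← C_mul]
    congr 2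
    field_simp
  simp only [repA, repD, repX, Module.End.mul_apply, LinearMap.coe_mk, AddHom.coe_mk, map_mul,
    map_add, map_one, aeval_C, map_pow, aeval_X, add_sub_cancel_right, LinearMap.add_apply,
    Module.End.one_apply, LinearMap.smul_apply, Pi.add_apply, Pi.smul_apply,
    aeval_C_mul_X_aeval_C_mul_X (mul_inv_cancel₀ hq), Polynomial.algebraMap_eq, h1,
    Polynomial.smul_eq_C_mul]
  ring

theorem repD_mul_repA {q : ℂ} (hq : q ≠ 0) : repD q * repA q = 1 + q⁻¹ • (repX * repX) := by
  ext1 F; ext1 n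
  simp only [repA, repD, repX, Module.End.mul_apply, LinearMap.coe_mk, AddHom.coe_mk,
    sub_add_cancel, LinearMap.add_apply, Module.End.one_apply, LinearMap.smul_apply, Pi.add_apply,
    Pi.smul_apply, aeval_C_mul_X_aeval_C_mul_X (inv_mul_cancel₀ hq), Polynomial.smul_eq_C_mul]
  ring

theorem isQuantumMatrix_rep {q : ℂ} (hq : q ≠ 0) :
    IsQuantumMatrix q (repA q) repX repX (repD q) := by
  have hA : repA q * repX = q • (repX * repA q) := by
    ext1 F; ext1 n
    simp [repA, repX, Polynomial.smul_eq_C_mul, mul_assoc]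
  have hD : repX * repD q = q • (repD q * repX) := by
    ext1 F; ext1 n
    have : (C q : ℂ[X]) * C q⁻¹ = 1 := by rw [← C_mul, mul_inv_cancel₀ hq, C_1]
    simp only [repX, repD, Module.End.mul_apply, LinearMap.coe_mk, AddHom.coe_mk,
      LinearMap.smul_apply, Pi.smul_apply, map_mul, aeval_X, Polynomial.smul_eq_C_mul]
    linear_combination (-(1 + C q⁻¹ * X ^ 2) * X * aeval (C q⁻¹ * X) (F (n - 1))) * this
  refine ⟨hA, hA, hD, hD, rfl, ?_⟩
  rw [repA_mul_repD hq, repD_mul_repA hq, sub_smul]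
  abel

theorem repA_single (q : ℂ) (n : ℤ) (w : ℂ[X]) :
    repA q (Pi.single n w) = Pi.single (n - 1) (aeval (C q * X) w) := by
  ext1 m
  rcases eq_or_ne m (n - 1) with rfl | hm
  · simp [repA]
  · rw [Pi.single_eq_of_ne hm]
    simp [repA, Pi.single_eq_of_ne (show m + 1 ≠ n by omega)]

theorem repD_single (q : ℂ) (n : ℤ) (w : ℂ[X]) :
    repD q (Pi.single n w) = Pi.single (n + 1) ((1 + C q⁻¹ * X ^ 2) * aeval (C q⁻¹ * X) w) := by
  ext1 m
  rcases eq_or_ne m (n + 1) with rfl | hm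
  · simp [repD]
  · rw [Pi.single_eq_of_ne hm]
    simp [repD, Pi.single_eq_of_ne (show m - 1 ≠ n by omega)]

theorem repX_single (n : ℤ) (w : ℂ[X]) : repX (Pi.single n w) = Pi.single n (X * w) := by
  ext1 m
  rcases eq_or_ne m n with rfl | hm <;> simp [repX, *]

theorem repX_pow_single (k : ℕ) (n : ℤ) (w : ℂ[X]) :
    (repX ^ k) (Pi.single n w) = Pi.single n (X ^ k * w) := by
  induction k with
  | zero => simp
  | succ k ih => rw [pow_succ', Module.End.mul_apply, ih, repX_single, ← mul_assoc, ← pow_succ']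

theorem aeval_repX_sq_single (f : ℂ[X]) (n : ℤ) (w : ℂ[X]) :
    aeval (repX * repX) f (Pi.single n w) = Pi.single n (expand ℂ 2 f * w) := by
  induction f using Polynomial.induction_on' with
  | add f g hf hg => simp only [map_add, LinearMap.add_apply, hf, hg, add_mul, Pi.single_add]
  | monomial k r =>
    rw [aeval_monomial, ← sq, ← pow_mul, Module.End.mul_apply, repX_pow_single,
      Module.algebraMap_end_apply, ← Pi.single_smul, expand_monomial, ← C_mul_X_pow_eq_monomial,
      Polynomial.smul_eq_C_mul, mul_assoc, mul_comm k]

theorem aeval_C_mul_X_ne_zero {r : ℂ} (hr : r ≠ 0) {w : ℂ[X]} (hw : w ≠ 0) :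
    aeval (C r * X) w ≠ 0 := fun h => hw <| by
  rw [← aeval_C_mul_X_aeval_C_mul_X (inv_mul_cancel₀ hr) w, h, map_zero]

theorem exists_repD_pow_single {q : ℂ} (hq : q ≠ 0) (k : ℕ) :
    ∃ w : ℂ[X], w ≠ 0 ∧ (repD q ^ k) (Pi.single 0 1) = Pi.single (k : ℤ) w := by
  induction k with
  | zero => exact ⟨1, one_ne_zero, rfl⟩
  | succ k ih =>
    obtain ⟨w, hw, h⟩ := ih
    refine ⟨_, mul_ne_zero ?_ (aeval_C_mul_X_ne_zero (inv_ne_zero hq) hw), by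
      rw [pow_succ', Module.End.mul_apply, h, repD_single]; push_cast; rfl⟩
    intro h0
    simpa using congrArg (Polynomial.eval 0) h0

theorem exists_repA_pow_single {q : ℂ} (hq : q ≠ 0) (k : ℕ) {w : ℂ[X]} (hw : w ≠ 0) :
    ∃ w' : ℂ[X], w' ≠ 0 ∧ (repA q ^ k) (Pi.single 0 w) = Pi.single (-k : ℤ) w' := by
  induction k with
  | zero => exact ⟨w, hw, by simp⟩
  | succ k ih =>
    obtain ⟨w', hw', h⟩ := ih
    refine ⟨_, aeval_C_mul_X_ne_zero hq hw', ?_⟩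
    rw [pow_succ', Module.End.mul_apply, h, repA_single]
    congr 1
    push_cast; ring

/-- A family of elements of quantum `GL₂`, homogeneous for the torus action, with one polynomial
coefficient of every degree in every weight, is linearly independent. -/
theorem linearIndependent_of_rep {q : ℂ} (hq : q ≠ 0) {G : Type} [Ring G] [Algebra ℂ G]
    {a b c d z : G} (ρ : G →ₐ[ℂ] Module.End ℂ (ℤ → ℂ[X])) (ha : ρ a = repA q) (hb : ρ b = repX)
    (hc : ρ c = repX) (hd : ρ d = repD q) (hz : ρ z = repX * repX) {u : G} (hu : ρ u = 1)
    (g : (Σ _ : ℤ, ℕ) → G)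
    (hpos : ∀ n k : ℕ, ∃ Q : ℂ[X], Q.degree = k ∧
      g ⟨n, k⟩ = aeval z Q * (b ^ n * d ^ n * u ^ n))
    (hneg : ∀ n k : ℕ, ∃ Q : ℂ[X], Q.degree = k ∧
      g ⟨Int.negSucc n, k⟩ = aeval z Q * (a ^ (n + 1) * c ^ (n + 1) * u ^ (n + 1))) :
    LinearIndependent ℂ g := by
  have key (n : ℤ) : ∃ (w : ℂ[X]) (Q : Polynomial.Sequence ℂ), w ≠ 0 ∧
      ∀ k, ρ (g ⟨n, k⟩) (Pi.single 0 1) = Pi.single n (expand ℂ 2 (Q k) * w) := by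
    have hzQ (Q : ℂ[X]) : ρ (aeval z Q) = aeval (repX * repX) Q := by rw [← hz, aeval_algHom_apply]
    cases n with
    | ofNat n =>
      choose Q hQ hg using hpos n
      obtain ⟨w, hw, h⟩ := exists_repD_pow_single hq n
      refine ⟨X ^ n * w, ⟨Q, hQ⟩, mul_ne_zero (pow_ne_zero n X_ne_zero) hw, fun k => ?_⟩
      erw [hg k]
      simp only [map_mul, map_pow, hzQ, hb, hd, hu, one_pow, mul_one, Module.End.mul_apply, h,
        repX_pow_single, aeval_repX_sq_single]
      rfl
    | negSucc n =>
      choose Q hQ hg using hneg n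
      obtain ⟨w, hw, h⟩ := exists_repA_pow_single hq (n + 1)
        (mul_ne_zero (pow_ne_zero (n + 1) X_ne_zero) one_ne_zero)
      refine ⟨w, ⟨Q, hQ⟩, hw, fun k => ?_⟩
      rw [hg k]
      simp only [map_mul, map_pow, hzQ, ha, hc, hu, one_pow, mul_one, Module.End.mul_apply,
        repX_pow_single]
      rw [mul_one] at h
      rw [h, aeval_repX_sq_single]
      rfl
  choose w Q hw hg using key
  set Ψ : G →ₗ[ℂ] (ℤ → ℂ[X]) := (LinearMap.applyₗ (Pi.single 0 1)) ∘ₗ ρ.toLinearMap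
  refine LinearIndependent.of_comp Ψ ?_
  have hind : ∀ n, LinearIndependent ℂ fun k => expand ℂ 2 (Q n k) * w n := fun n => by
    refine (Q n).linearIndependent.map' (LinearMap.mulRight ℂ (w n) ∘ₗ (expand ℂ 2).toLinearMap)
      (LinearMap.ker_eq_bot.2 ?_)
    exact (mul_left_injective₀ (hw n)).comp (expand_injective two_pos)
  convert! Pi.linearIndependent_single _ hind using 1
  ext1 ⟨n, k⟩
  exact hg n k

end Representation

theorem degree_smul_comp_sub_smul {α β r : ℂ} {k : ℕ} {Q : ℂ[X]} (hQ : Q.degree = k)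
    (h : α * r ^ k ≠ β) : (α • Q.comp (C r * X) - β • Q).degree = k := by
  have hcoeff (i : ℕ) :
      (α • Q.comp (C r * X) - β • Q).coeff i = (α * r ^ i - β) * Q.coeff i := by
    simp only [coeff_sub, coeff_smul, comp_C_mul_X_coeff, smul_eq_mul]
    ring
  refine degree_eq_of_le_of_coeff_ne_zero ((degree_le_iff_coeff_zero _ _).2 fun i hi => ?_) ?_
  · rw [hcoeff, coeff_eq_zero_of_degree_lt (hQ ▸ hi), mul_zero]
  · rw [hcoeff]
    exact mul_ne_zero (sub_ne_zero.2 h) (coeff_ne_zero_of_eq_degree hQ)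

/-- The data of the co-orbit map `κ = β^ξ` on the quantum `2 × 2` matrix `(A, B; C, D)`, with
`u` the inverse of the quantum determinant of `(a, b; c, d)`. -/
structure IsCoorbit (q ξ1 ξ2 : ℂ) {M G : Type} [Ring M] [Algebra ℂ M] [Ring G] [Algebra ℂ G]
    (A B C D : M) (a b c d u : G) (κ : M →ₗ[ℂ] G) : Prop where
  rel : IsQuantumMatrix q a b c d
  ua : Commute u a
  ub : Commute u b
  uc : Commute u c
  ud : Commute u d
  u_det : u * (a * d - q • (b * c)) = 1
  one : κ 1 = 1
  mul_A (h : M) : κ (h * A) = u * (ξ1 • (d * κ h * a) - (q⁻¹ * ξ2) • (b * κ h * c))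
  mul_B (h : M) : κ (h * B) = u * (ξ1 • (d * κ h * b) - (q⁻¹ * ξ2) • (b * κ h * d))
  mul_C (h : M) : κ (h * C) = u * (ξ2 • (a * κ h * c) - (q * ξ1) • (c * κ h * a))
  mul_D (h : M) : κ (h * D) = u * (ξ2 • (a * κ h * d) - (q * ξ1) • (c * κ h * b))

namespace IsCoorbit

variable {q ξ1 ξ2 : ℂ} {M G : Type} [Ring M] [Algebra ℂ M] [Ring G] [Algebra ℂ G]
  {A B C D : M} {a b c d u : G} {κ : M →ₗ[ℂ] G}

theorem u_da (h : IsCoorbit q ξ1 ξ2 A B C D a b c d u κ) :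
    u * (d * a) = 1 + q⁻¹ • (u * (b * c)) := by
  rw [h.rel.da_eq, mul_add, h.u_det, mul_smul_comm]

theorem d_z (h : IsCoorbit q ξ1 ξ2 A B C D a b c d u κ) (hq : q ≠ 0) :
    d * (u * (b * c)) = (q ^ 2)⁻¹ • (u * (b * c) * d) := by
  rw [← mul_assoc, ← h.ud.eq, mul_assoc, h.rel.d_bc hq, mul_smul_comm, mul_assoc u (b * c)]

theorem a_z (h : IsCoorbit q ξ1 ξ2 A B C D a b c d u κ) :
    a * (u * (b * c)) = q ^ 2 • (u * (b * c) * a) := by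
  rw [← mul_assoc, ← h.ua.eq, mul_assoc, h.rel.a_bc, mul_smul_comm, mul_assoc u (b * c)]

theorem b_z (h : IsCoorbit q ξ1 ξ2 A B C D a b c d u κ) : Commute b (u * (b * c)) :=
  h.ub.symm.mul_right ((Commute.refl b).mul_right h.rel.bc)

theorem c_z (h : IsCoorbit q ξ1 ξ2 A B C D a b c d u κ) : Commute c (u * (b * c)) :=
  h.uc.symm.mul_right ((Commute.mul_right h.rel.bc.symm (Commute.refl c)))

theorem u_z (h : IsCoorbit q ξ1 ξ2 A B C D a b c d u κ) : Commute u (u * (b * c)) :=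
  (Commute.refl u).mul_right (h.ub.mul_right h.uc)

theorem commute_aeval {y z : G} (h : Commute y z) (f : ℂ[X]) : y * aeval z f = aeval z f * y := by
  have := mul_aeval_eq (r := 1) (u := y) (z := z) (by rw [one_smul, h.eq]) f
  simpa using this

theorem u_mul_aeval_mul {y z e w : G} {r : ℂ} (hu : Commute u z) (hy : y * z = r • (z * y))
    (f : ℂ[X]) :
    u * (y * (aeval z f * e) * w) = aeval z (f.comp (Polynomial.C r * X)) * (u * (y * e * w)) := by
  rw [← mul_assoc y, mul_aeval_eq hy, mul_assoc _ y e, mul_assoc (aeval z _), ← mul_assoc u,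
    commute_aeval hu, mul_assoc]

theorem u_mul_aeval_mul_of_commute {y z e w : G} (hu : Commute u z) (hy : Commute y z)
    (f : ℂ[X]) : u * (y * (aeval z f * e) * w) = aeval z f * (u * (y * e * w)) := by
  simpa using u_mul_aeval_mul (r := 1) (e := e) (w := w) hu (by rw [one_smul, hy.eq]) f

theorem exists_pow_A (h : IsCoorbit q ξ1 ξ2 A B C D a b c d u κ) (hq : q ≠ 0)
    (hsep : ∀ k : ℕ, ξ1 - q ^ (2 * k) * ξ2 ≠ 0) (k : ℕ) :
    ∃ P : ℂ[X], P.degree = k ∧ κ (A ^ k) = aeval (u * (b * c)) P := by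
  induction k with
  | zero => exact ⟨1, by simp, by simp [h.one]⟩
  | succ k ih =>
    obtain ⟨P, hP, hκ⟩ := ih
    set r := (q ^ 2)⁻¹ with hr
    set z := u * (b * c) with hz
    have hdeg := degree_smul_comp_sub_smul (α := ξ1) (β := ξ2) (r := r) hP (by
      intro h0
      apply hsep k
      rw [← h0, hr, inv_pow, ← pow_mul]
      field_simp
      ring)
    set L := ξ1 • P.comp (Polynomial.C r * X) - ξ2 • P with hL
    refine ⟨ξ1 • P.comp (Polynomial.C r * X) + q⁻¹ • (L * X), ?_, ?_⟩
    · have h1 : (q⁻¹ • (L * X)).degree = ((k + 1 : ℕ) : WithBot ℕ) := by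
        rw [Polynomial.smul_eq_C_mul, degree_C_mul (inv_ne_zero hq), degree_mul_X, hdeg]
        rfl
      rw [degree_add_eq_right_of_degree_lt, h1]
      rw [h1]
      refine lt_of_le_of_lt ((degree_smul_le _ _).trans ?_)
        (WithBot.coe_lt_coe.2 (Nat.lt_succ_self k))
      refine (degree_le_iff_coeff_zero _ _).2 fun i hi => ?_
      rw [comp_C_mul_X_coeff, coeff_eq_zero_of_degree_lt (hP ▸ hi), zero_mul]
    · have hd := u_mul_aeval_mul (e := 1) (w := a) h.u_z (h.d_z hq) P
      have hb := u_mul_aeval_mul_of_commute (e := 1) (w := c) h.u_z h.b_z P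
      rw [mul_one, mul_one, h.u_da] at hd
      rw [mul_one, mul_one] at hb
      rw [pow_succ, h.mul_A, hκ, mul_sub, mul_smul_comm, mul_smul_comm, hd, hb, ← hz, ← hr]
      simp only [hL, map_add, map_sub, map_smul, map_mul, aeval_X, mul_add, mul_one, smul_add,
        smul_sub, sub_mul, smul_mul_assoc, mul_smul_comm, smul_smul]
      rw [mul_comm ξ1 q⁻¹]
      abel

theorem u_mul_pow {v w : G} (hv : Commute u v) (hw : Commute u w)
    (hwv : w * v = q⁻¹ • (v * w)) (n : ℕ) :
    u * (w * (v ^ n * w ^ n * u ^ n) * v) =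
      q⁻¹ ^ (2 * n + 1) • (v ^ (n + 1) * w ^ (n + 1) * u ^ (n + 1)) ∧
    u * (v * (v ^ n * w ^ n * u ^ n) * w) = v ^ (n + 1) * w ^ (n + 1) * u ^ (n + 1) := by
  have hcomm : Commute u (v ^ (n + 1) * w ^ (n + 1)) :=
    (hv.pow_right _).mul_right (hw.pow_right _)
  constructor
  · have h1 : w * (v ^ n * w ^ n * u ^ n) * v = w * v ^ n * w ^ n * v * u ^ n := by
      simp only [mul_assoc]
      rw [(hv.pow_left n).eq]
    have h2 : v ^ n * w * w ^ n * v = q⁻¹ ^ (n + 1) • (v ^ (n + 1) * w ^ (n + 1)) := by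
      rw [mul_assoc (v ^ n), ← pow_succ', mul_assoc, pow_mul_eq_smul hwv, mul_smul_comm,
        ← mul_assoc, ← pow_succ]
    rw [h1, mul_pow_eq_smul hwv]
    simp only [smul_mul_assoc]
    rw [h2, smul_mul_assoc, mul_smul_comm, mul_smul_comm, smul_smul, ← mul_assoc, hcomm.eq,
      mul_assoc, ← pow_succ', ← pow_add]
    congr 2
    ring
  · have h1 : v * (v ^ n * w ^ n * u ^ n) * w = v ^ (n + 1) * w ^ (n + 1) * u ^ n := by
      rw [pow_succ', pow_succ]
      simp only [mul_assoc]
      rw [(hw.pow_left n).eq]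
    rw [h1, ← mul_assoc, hcomm.eq, mul_assoc, ← pow_succ']

theorem exists_pow_A_mul_pow_B (h : IsCoorbit q ξ1 ξ2 A B C D a b c d u κ) (hq : q ≠ 0)
    (hsep : ∀ k : ℕ, ξ1 - q ^ (2 * k) * ξ2 ≠ 0) (n k : ℕ) :
    ∃ Q : ℂ[X], Q.degree = k ∧
      κ (A ^ k * B ^ n) = aeval (u * (b * c)) Q * (b ^ n * d ^ n * u ^ n) := by
  induction n with
  | zero => simpa using h.exists_pow_A hq hsep k
  | succ n ih =>
    obtain ⟨Q, hQ, hκ⟩ := ih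
    obtain ⟨h1, h2⟩ := u_mul_pow h.ub h.ud (h.rel.db hq) n
    refine ⟨_, degree_smul_comp_sub_smul (α := ξ1 * q⁻¹ ^ (2 * n + 1)) (β := q⁻¹ * ξ2)
      (r := (q ^ 2)⁻¹) hQ ?_, ?_⟩
    · intro h0
      apply hsep (n + k)
      have h3 : q⁻¹ * ξ2 * q ^ (2 * (n + k) + 1) = ξ1 := by
        rw [← h0, inv_pow, inv_pow, ← pow_mul]
        field_simp
        ring
      rw [← h3]
      field_simp
      ring
    · rw [pow_succ, ← mul_assoc, h.mul_B, hκ, mul_sub, mul_smul_comm, mul_smul_comm,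
        u_mul_aeval_mul h.u_z (h.d_z hq), u_mul_aeval_mul_of_commute h.u_z h.b_z, h1, h2]
      simp only [map_sub, map_smul, sub_mul, smul_mul_assoc, mul_smul_comm, smul_smul]

theorem exists_pow_A_mul_pow_C (h : IsCoorbit q ξ1 ξ2 A B C D a b c d u κ) (hq : q ≠ 0)
    (hsep : ∀ k : ℕ, ξ1 - q ^ (2 * k) * ξ2 ≠ 0) (n k : ℕ) :
    ∃ Q : ℂ[X], Q.degree = k ∧
      κ (A ^ k * C ^ n) = aeval (u * (b * c)) Q * (a ^ n * c ^ n * u ^ n) := by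
  induction n with
  | zero => simpa using h.exists_pow_A hq hsep k
  | succ n ih =>
    obtain ⟨Q, hQ, hκ⟩ := ih
    obtain ⟨h1, h2⟩ := u_mul_pow h.ua h.uc (h.rel.ca hq) n
    refine ⟨_, degree_smul_comp_sub_smul (α := ξ2) (β := q * ξ1 * q⁻¹ ^ (2 * n + 1))
      (r := q ^ 2) hQ ?_, ?_⟩
    · intro h0
      apply hsep (n + k)
      have h3 : ξ2 * (q ^ 2) ^ k * q ^ (2 * n) = ξ1 := by
        rw [h0, inv_pow]
        field_simp
        ring
      rw [← h3]
      ring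
    · rw [pow_succ, ← mul_assoc, h.mul_C, hκ, mul_sub, mul_smul_comm, mul_smul_comm,
        u_mul_aeval_mul h.u_z h.a_z, u_mul_aeval_mul_of_commute h.u_z h.c_z, h1, h2]
      simp only [map_sub, map_smul, sub_mul, smul_mul_assoc, mul_smul_comm, smul_smul]

theorem map_trace (h : IsCoorbit q ξ1 ξ2 A B C D a b c d u κ) (hq : q ≠ 0) :
    κ ((q ^ 2)⁻¹ • A + (q ^ 4)⁻¹ • D) = ((q ^ 2)⁻¹ * ξ1 + (q ^ 4)⁻¹ * ξ2) • 1 := by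
  have hA := h.mul_A 1
  have hD := h.mul_D 1
  have h1 := h.u_da
  have h2 : u * (a * d) = 1 + q • (u * (b * c)) := by
    rw [← h.u_det, mul_sub, mul_smul_comm]; abel
  rw [one_mul, h.one, mul_one, mul_one, mul_sub, mul_smul_comm, mul_smul_comm, h1] at hA
  rw [one_mul, h.one, mul_one, mul_one, mul_sub, mul_smul_comm, mul_smul_comm, ← h.rel.bc, h2] at hD
  rw [map_add, map_smul, map_smul, hA, hD]
  match_scalars <;> field_simp
  ring

theorem map_det (h : IsCoorbit q ξ1 ξ2 A B C D a b c d u κ) (hq : q ≠ 0) :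
    κ (A * D - q • (B * C)) = (ξ1 * ξ2) • 1 := by
  have hA : κ A = ξ1 • 1 + (q⁻¹ * (ξ1 - ξ2)) • (u * (b * c)) := by
    have := h.mul_A 1
    rw [one_mul, h.one, mul_one, mul_one, mul_sub, mul_smul_comm, mul_smul_comm, h.u_da] at this
    rw [this]
    module
  have hB : κ B = (q⁻¹ * (ξ1 - ξ2)) • (u * (b * d)) := by
    have := h.mul_B 1
    rw [one_mul, h.one, mul_one, mul_one, h.rel.db hq, mul_sub, mul_smul_comm, mul_smul_comm,
      mul_smul_comm] at this
    rw [this]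
    module
  have e1 : a * (u * (b * c)) * d = u * (a * b * c * d) := by
    rw [← mul_assoc, ← h.ua.eq]; simp only [mul_assoc]
  have e2 : a * (u * (b * d)) * c = q⁻¹ • (u * (a * b * c * d)) := by
    rw [← mul_assoc, ← h.ua.eq]; simp only [mul_assoc, h.rel.dc hq, mul_smul_comm]
  have e3 : c * (u * (b * c)) * b = u * (b * c * (b * c)) := by
    rw [h.c_z.eq, mul_assoc, ← h.rel.bc, mul_assoc]
  have e4 : c * (u * (b * d)) * a = b * c + q⁻¹ • (u * (b * c * (b * c))) := by
    have h5 : u * (b * c) = b * c * u := (h.ub.mul_right h.uc).eq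
    have : c * (u * (b * d)) * a = b * c * (u * (d * a)) := by
      rw [← mul_assoc, ← h.uc.eq, ← mul_assoc (b * c) u, ← h5, h.rel.bc]
      simp only [mul_assoc]
    rw [this, h.u_da, mul_add, mul_one, mul_smul_comm, ← mul_assoc (b * c) u, ← h5, mul_assoc u]
  have e5 : u * (a * d) = 1 + q • (u * (b * c)) := by
    rw [← h.u_det, mul_sub, mul_smul_comm]; abel
  rw [map_sub, map_smul, h.mul_D, h.mul_C, hA, hB]
  simp only [mul_add, add_mul, mul_smul_comm, smul_mul_assoc, mul_one, e1, e2, e3, e4, mul_sub,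
    ← h.rel.bc, e5]
  match_scalars <;> field_simp <;> ring

/-- An element sent to a scalar by the co-orbit map acts as that scalar on the left. -/
theorem map_mul_of_map_eq_smul_one (h : IsCoorbit q ξ1 ξ2 A B C D a b c d u κ)
    (hgen : Algebra.adjoin ℂ {A, B, C, D} = ⊤) {τ : M} {r : ℂ} (hτ : κ τ = r • 1) (m : M) :
    κ (τ * m) = r • κ m := by
  have htop := Submodule.eq_top_of_mul_mem hgen
    (LinearMap.ker (κ ∘ₗ LinearMap.mulLeft ℂ τ - r • κ)) (by simp [hτ, h.one]) (by
      intro w hw y hy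
      have hw' : κ (τ * w) = r • κ w := by simpa [sub_eq_zero] using hw
      suffices κ (τ * w * y) = r • κ (w * y) by simpa [sub_eq_zero, ← mul_assoc] using this
      rcases hy with rfl | rfl | rfl | rfl
      · simp only [h.mul_A, hw', mul_smul_comm, smul_mul_assoc, smul_comm _ r, ← smul_sub]
      · simp only [h.mul_B, hw', mul_smul_comm, smul_mul_assoc, smul_comm _ r, ← smul_sub]
      · simp only [h.mul_C, hw', mul_smul_comm, smul_mul_assoc, smul_comm _ r, ← smul_sub]
      · simp only [h.mul_D, hw', mul_smul_comm, smul_mul_assoc, smul_comm _ r, ← smul_sub])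
  have hm : m ∈ LinearMap.ker (κ ∘ₗ LinearMap.mulLeft ℂ τ - r • κ) := htop ▸ Submodule.mem_top
  simpa [sub_eq_zero] using hm

end IsCoorbit

theorem ker_eq_of_sup_span_eq_top {M G I : Type*} [AddCommGroup M] [Module ℂ M] [AddCommGroup G]
    [Module ℂ G] {κ : M →ₗ[ℂ] G} {J : Submodule ℂ M} {v : I → M} (hJ : J ≤ LinearMap.ker κ)
    (htop : J ⊔ Submodule.span ℂ (Set.range v) = ⊤) (hind : LinearIndependent ℂ fun i => κ (v i)) :
    LinearMap.ker κ = J := by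
  refine le_antisymm (fun m hm => ?_) hJ
  obtain ⟨j, hj, y, hy, rfl⟩ := Submodule.mem_sup.1 (htop ▸ Submodule.mem_top : m ∈ J ⊔ _)
  have hy0 : κ y = 0 := by
    rw [LinearMap.mem_ker, map_add, LinearMap.mem_ker.1 (hJ hj), zero_add] at hm
    exact hm
  obtain ⟨l, rfl⟩ := Finsupp.mem_span_range_iff_exists_finsupp.1 hy
  have hl : l = 0 := by
    refine linearIndependent_iff.1 hind l ?_
    rw [Finsupp.linearCombination_apply, ← hy0, Finsupp.sum, Finsupp.sum, map_sum]
    simp only [map_smul]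
  simpa [hl] using hj

theorem qdet_fin_two {A M : Type} [CommRing A] [Ring M] [Algebra A M] (q : A)
    (x : Fin 2 → Fin 2 → M) : qdet q x = x 0 0 * x 1 1 - q • (x 0 1 * x 1 0) := by
  have hord (f : Fin 2 → Fin 2) (hf : f 0 < f 1) (k : Fin 2) : f k = k := by
    revert f k; decide
  have horder (k : Fin 2) : (((Finset.univ : Finset (Fin 2)).orderIsoOfFin rfl) k).1 = k :=
    hord (fun k => (((Finset.univ : Finset (Fin 2)).orderIsoOfFin rfl) k).1)
      (((Finset.univ : Finset (Fin 2)).orderIsoOfFin rfl).strictMono (by decide)) k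
  have hid : invCount (1 : Equiv.Perm (Fin 2)) = 0 := by decide
  have hswap : invCount (Equiv.swap (0 : Fin 2) 1) = 1 := by decide
  change ∑ σ : Equiv.Perm (Fin 2), ((-q) ^ invCount σ) •
      ((List.finRange 2).map fun k : Fin 2 =>
        x ((Finset.univ : Finset (Fin 2)).orderIsoOfFin rfl k).1
          ((Finset.univ : Finset (Fin 2)).orderIsoOfFin rfl (σ k)).1).prod = _
  simp only [horder]
  rw [show (Finset.univ : Finset (Equiv.Perm (Fin 2))) = {1, Equiv.swap 0 1} by decide,
    Finset.sum_pair (by decide), hid, hswap]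
  simp [List.finRange_succ, sub_eq_add_neg]

theorem IsQuantumMatrix.eq_of_mul_col {R : Type} [Ring R] [Algebra ℂ R] {q : ℂ} {a b c d u : R}
    (h : IsQuantumMatrix q a b c d) (hq : q ≠ 0) (hu : (a * d - q • (b * c)) * u = 1)
    {y z r s : R} (h1 : y * a + z * c = r) (h2 : y * b + z * d = s) :
    y = (r * d - q • (s * c)) * u ∧ z = (s * a - q⁻¹ • (r * b)) * u := by
  have h3 : y * (a * d - q • (b * c)) = r * d - q • (s * c) := by
    rw [← h1, ← h2, add_mul, add_mul, mul_assoc z c, h.cd]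
    simp only [mul_sub, mul_smul_comm, mul_assoc, smul_add]
    abel
  have h4 : z * (a * d - q • (b * c)) = s * a - q⁻¹ • (r * b) := by
    have h5 : a * d - q • (b * c) = d * a - q⁻¹ • (b * c) := by rw [h.da_eq]; abel
    rw [h5, ← h1, ← h2, add_mul, add_mul, mul_assoc y a, h.ab, h.bc]
    simp only [mul_sub, mul_smul_comm, mul_assoc, smul_add, inv_smul_smul₀ hq]
    abel
  constructor
  · rw [← h3, mul_assoc, hu, mul_one]
  · rw [← h4, mul_assoc, hu, mul_one]

theorem algHom_ext_of_adjoin_union_inv {A G B I : Type*} [CommRing A] [Ring G] [Algebra A G]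
    [Semiring B] [Algebra A B] {v : I → G} {D u : G}
    (hD : D ∈ Algebra.adjoin A (Set.range v)) (hu1 : D * u = 1) (hu2 : u * D = 1)
    (hgen : Algebra.adjoin A (Set.range v ∪ {u}) = ⊤) {f g : G →ₐ[A] B}
    (h : ∀ i, f (v i) = g (v i)) : f = g := by
  have hfg : Set.EqOn f g (Algebra.adjoin A (Set.range v) : Set G) :=
    AlgHom.eqOn_adjoin_iff.2 (by rintro _ ⟨i, rfl⟩; exact h i)
  refine AlgHom.ext_of_adjoin_eq_top hgen ?_
  rintro _ (⟨i, rfl⟩ | rfl)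
  · exact h i
  · refine left_inv_eq_right_inv (a := f D) ?_ ?_
    · rw [← map_mul, hu2, map_one]
    · rw [hfg hD, ← map_mul, hu1, map_one]
/-- `N = 2`, `q` not a root of unity, `ξ = diag(ξ₁, ξ₂)` with `ξ₁ - q^(2k) ξ₂ ≠ 0`
for all `k ≥ 0`: the kernel of `β^ξ` is the right ideal generated by
`τ₁ - τ₁(ξ)` and `τ₂ - τ₂(ξ)`. -/
theorem ker_coorbit_beta_2x2
    (q : ℂ) (hq : q ≠ 0) (hqru : (∀ n : ℕ, 0 < n → q ^ n ≠ 1) ∨ q = 1)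
    (M G : Type) [Ring M] [Algebra ℂ M] [Ring G] [Algebra ℂ G]
    (x : Fin 2 → Fin 2 → M)
    (hrow : ∀ i j l : Fin 2, j < l → x i j * x i l = (q) • (x i l * x i j))
    (hcol : ∀ i k j : Fin 2, i < k → x i j * x k j = (q) • (x k j * x i j))
    (hanti : ∀ i k j l : Fin 2, i < k → j < l → x i l * x k j = x k j * x i l)
    (hdiag : ∀ i k j l : Fin 2, i < k → j < l →
      x i j * x k l - x k l * x i j = ((q) - (q⁻¹)) • (x i l * x k j))
    (hgen : Algebra.adjoin ℂ (Set.range fun p : Fin 2 × Fin 2 => x p.1 p.2) = ⊤)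
    (hfree : ∀ (B : Type) [Ring B] [Algebra ℂ B] (y : Fin 2 → Fin 2 → B),
      (∀ i j l : Fin 2, j < l → y i j * y i l = (q) • (y i l * y i j)) →
      (∀ i k j : Fin 2, i < k → y i j * y k j = (q) • (y k j * y i j)) →
      (∀ i k j l : Fin 2, i < k → j < l → y i l * y k j = y k j * y i l) →
      (∀ i k j l : Fin 2, i < k → j < l →
        y i j * y k l - y k l * y i j = ((q) - (q⁻¹)) • (y i l * y k j)) →
      ∃! φ : M →ₐ[ℂ] B, ∀ i j, φ (x i j) = y i j)
    (ι : M →ₐ[ℂ] G) (dInv : G)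
    (hd1 : ι (qdet (q) x) * dInv = 1)
    (hd2 : dInv * ι (qdet (q) x) = 1)
    (hgenG : Algebra.adjoin ℂ
      (Set.range (fun p : Fin 2 × Fin 2 => ι (x p.1 p.2)) ∪ {dInv}) = ⊤)
    (hfreeG : ∀ (B : Type) [Ring B] [Algebra ℂ B] (φ : M →ₐ[ℂ] B) (u : B),
      φ (qdet (q) x) * u = 1 → u * φ (qdet (q) x) = 1 →
      ∃! ψ : G →ₐ[ℂ] B, ψ.comp ι = φ)
    (ΔM : M →ₐ[ℂ] M ⊗[ℂ] M)
    (hΔM : ∀ i j, ΔM (x i j) = ∑ k, x i k ⊗ₜ[ℂ] x k j)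
    (ΔG : G →ₐ[ℂ] G ⊗[ℂ] G)
    (hΔG : ∀ m, ΔG (ι m) = Algebra.TensorProduct.map ι ι (ΔM m))
    (εG : G →ₐ[ℂ] ℂ)
    (hεG : ∀ i j, εG (ι (x i j)) = if i = j then 1 else 0)
    (St : G →ₗ[ℂ] G)
    (hS1 : LinearMap.mul' ℂ G ∘ₗ TensorProduct.map St LinearMap.id ∘ₗ ΔG.toLinearMap
      = Algebra.linearMap ℂ G ∘ₗ εG.toLinearMap)
    (hS2 : LinearMap.mul' ℂ G ∘ₗ TensorProduct.map LinearMap.id St ∘ₗ ΔG.toLinearMap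
      = Algebra.linearMap ℂ G ∘ₗ εG.toLinearMap)
    (ξ1 ξ2 : ℂ) (e : M →ₐ[ℂ] ℂ)
    (he00 : e (x 0 0) = ξ1) (he01 : e (x 0 1) = 0)
    (he10 : e (x 1 0) = 0) (he11 : e (x 1 1) = ξ2)
    (hsep : ∀ k : ℕ, ξ1 - q ^ (2 * k) * ξ2 ≠ 0) :
    LinearMap.ker (coorbit e (adjBeta ΔM ι St))
      = Submodule.span ℂ {y : M | ∃ h : M,
          y = (((q ^ 2)⁻¹ • x 0 0 + (q ^ 4)⁻¹ • x 1 1) - algebraMap ℂ M (e ((q ^ 2)⁻¹ • x 0 0 + (q ^ 4)⁻¹ • x 1 1))) * h ∨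
          y = ((x 0 0 * x 1 1 - q • (x 0 1 * x 1 0)) - algebraMap ℂ M (e (x 0 0 * x 1 1 - q • (x 0 1 * x 1 0)))) * h} := by
  set a := x 0 0 with ha
  set b := x 0 1 with hb
  set c := x 1 0 with hc
  set d := x 1 1 with hd
  have H : IsQuantumMatrix q a b c d :=
    ⟨hrow 0 0 1 (by decide), hcol 0 1 0 (by decide), hcol 0 1 1 (by decide),
      hrow 1 0 1 (by decide), hanti 0 1 0 1 (by decide) (by decide),
      sub_eq_iff_eq_add'.1 (hdiag 0 1 0 1 (by decide) (by decide))⟩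
  have hgen4 : Algebra.adjoin ℂ {a, b, c, d} = ⊤ := by
    rw [← top_le_iff, ← hgen]
    refine Algebra.adjoin_mono ?_
    rintro _ ⟨⟨i, j⟩, rfl⟩
    fin_cases i <;> fin_cases j <;> simp [ha, hb, hc, hd]
  have hlift (B : Type) [Ring B] [Algebra ℂ B] (y : Fin 2 → Fin 2 → B)
      (hy : IsQuantumMatrix q (y 0 0) (y 0 1) (y 1 0) (y 1 1)) :
      ∃! φ : M →ₐ[ℂ] B, ∀ i j, φ (x i j) = y i j := by
    apply hfree B y <;> simp only [Fin.forall_fin_two] <;>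
      simp [hy.ab, hy.ac, hy.bd, hy.cd, hy.bc, hy.ad]
  rw [qdet_fin_two] at hd1 hd2
  simp only [qdet_fin_two] at hfreeG
  rw [← ha, ← hb, ← hc, ← hd] at hd1 hd2 hfreeG
  have HG : IsQuantumMatrix q (ι a) (ι b) (ι c) (ι d) := H.map ι
  have hmem (i j : Fin 2) : ι (x i j) ∈ Algebra.adjoin ℂ
      (Set.range fun p : Fin 2 × Fin 2 => ι (x p.1 p.2)) := Algebra.subset_adjoin ⟨(i, j), rfl⟩
  have hext {B : Type} [Semiring B] [Algebra ℂ B] {f g : G →ₐ[ℂ] B}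
      (h : ∀ i j, f (ι (x i j)) = g (ι (x i j))) : f = g := by
    refine algHom_ext_of_adjoin_union_inv ?_ hd1 hd2 hgenG fun p => h p.1 p.2
    simp only [map_sub, map_mul, map_smul]
    exact sub_mem (mul_mem (hmem _ _) (hmem _ _))
      (Subalgebra.smul_mem _ (mul_mem (hmem _ _) (hmem _ _)) _)
  have hΔ (i j : Fin 2) : ΔG (ι (x i j)) = ∑ k, ι (x i k) ⊗ₜ[ℂ] ι (x k j) := by
    simp [hΔG, hΔM]
  have hS : ∀ u v, St (u * v) = St v * St u := by
    refine antipode_mul_rev ΔG εG St (hext fun i j => ?_) (hext fun i j => ?_)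
      (hext fun i j => ?_) hS1 hS2
    · simp [hΔ, TensorProduct.tmul_add, TensorProduct.add_tmul]
      abel
    · fin_cases i <;> fin_cases j <;> simp [hΔ, hεG]
    · fin_cases i <;> fin_cases j <;> simp [hΔ, hεG]
  have hSx (i j : Fin 2) : St (ι (x i 0)) * ι (x 0 j) + St (ι (x i 1)) * ι (x 1 j) =
      if i = j then 1 else 0 := by
    have := LinearMap.congr_fun hS1 (ι (x i j))
    simpa [hΔ, hεG] using this
  have hdet : (ι a * ι d - q • (ι b * ι c)) * dInv = 1 := by simpa using hd1
  have hdet' : dInv * (ι a * ι d - q • (ι b * ι c)) = 1 := by simpa using hd2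
  obtain ⟨hSa, hSb⟩ := HG.eq_of_mul_col hq hdet (hSx 0 0) (hSx 0 1)
  obtain ⟨hSc, hSd⟩ := HG.eq_of_mul_col hq hdet (hSx 1 0) (hSx 1 1)
  simp at hSa hSb hSc hSd
  have hcomm {y : G} (hy : (ι a * ι d - q • (ι b * ι c)) * y = y * (ι a * ι d - q • (ι b * ι c))) :
      Commute dInv y := by
    change dInv * y = y * dInv
    rw [← mul_one (dInv * y), ← hdet, mul_assoc, ← mul_assoc y, ← hy, ← mul_assoc, ← mul_assoc,
      hdet', one_mul]
  have hSt1 : St 1 = 1 := by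
    have := LinearMap.congr_fun hS1 1
    simpa [Algebra.TensorProduct.one_def] using this
  have hκ1 : coorbit e (adjBeta ΔM ι St) 1 = 1 := by
    simp [coorbit, adjBeta, Algebra.TensorProduct.one_def, hSt1]
  set κ := coorbit e (adjBeta ΔM ι St) with hκ
  have hκx (h : M) (i j : Fin 2) : κ (h * x i j) =
      ξ1 • (St (ι (x i 0)) * κ h * ι (x 0 j)) + ξ2 • (St (ι (x i 1)) * κ h * ι (x 1 j)) := by
    rw [hκ, coorbit_adjBeta_mul ΔM ι St hS e x hΔM]
    simp [Fin.sum_univ_two, ← ha, ← hb, ← hc, ← hd, he00, he01, he10, he11]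
  have ua := hcomm (HG.det_a hq)
  have ub := hcomm (HG.det_b hq)
  have uc := hcomm (HG.det_c hq)
  have ud := hcomm (HG.det_d hq)
  have K : IsCoorbit q ξ1 ξ2 a b c d (ι a) (ι b) (ι c) (ι d) dInv κ := by
    refine ⟨HG, ua, ub, uc, ud, hdet', hκ1, fun h => (hκx h 0 0).trans ?_,
      fun h => (hκx h 0 1).trans ?_, fun h => (hκx h 1 0).trans ?_, fun h => (hκx h 1 1).trans ?_⟩
    · rw [hSa, hSb, ← ud.eq, ← ub.eq]
      simp only [mul_sub, mul_smul_comm, smul_mul_assoc, mul_assoc, neg_mul]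
      module
    · rw [hSa, hSb, ← ud.eq, ← ub.eq]
      simp only [mul_sub, mul_smul_comm, smul_mul_assoc, mul_assoc, neg_mul]
      module
    · rw [hSc, hSd, ← ua.eq, ← uc.eq]
      simp only [mul_sub, mul_smul_comm, smul_mul_assoc, mul_assoc, neg_mul]
      module
    · rw [hSc, hSd, ← ua.eq, ← uc.eq]
      simp only [mul_sub, mul_smul_comm, smul_mul_assoc, mul_assoc, neg_mul]
      module
  obtain ⟨φ, hφ, -⟩ := hlift _ ![![repA q, repX], ![repX, repD q]] (isQuantumMatrix_rep hq)
  simp [Fin.forall_fin_two] at hφ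
  have hφdet : φ (a * d - q • (b * c)) = 1 := by
    simp [hφ, repA_mul_repD hq, ha, hb, hc, hd]
  obtain ⟨ρ, hρ, -⟩ := hfreeG _ φ 1 (by rw [hφdet, one_mul]) (by rw [hφdet, one_mul])
  have hρι (m : M) : ρ (ι m) = φ m := by rw [← hρ]; rfl
  have hρu : ρ dInv = 1 := by
    have := congrArg ρ hd1
    rwa [map_mul, hρι, hφdet, one_mul, map_one] at this
  set J := Submodule.span ℂ {y : M | ∃ h : M, _} with hJ
  set T := (q ^ 2)⁻¹ • a + (q ^ 4)⁻¹ • d with hT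
  set D := a * d - q • (b * c) with hD
  have heT : e T = (q ^ 2)⁻¹ * ξ1 + (q ^ 4)⁻¹ * ξ2 := by simp [hT, he00, he11]
  have heD : e D = ξ1 * ξ2 := by simp [hD, he00, he11, he01]
  have hJT (m : M) : T * m - e T • m ∈ J :=
    Submodule.subset_span ⟨m, Or.inl (by rw [Algebra.smul_def (e T) m, ← sub_mul])⟩
  have hJD (m : M) : D * m - e D • m ∈ J :=
    Submodule.subset_span ⟨m, Or.inr (by rw [Algebra.smul_def (e D) m, ← sub_mul])⟩
  have hJker : J ≤ LinearMap.ker κ := by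
    refine Submodule.span_le.2 ?_
    rintro _ ⟨m, rfl | rfl⟩
    · rw [SetLike.mem_coe, LinearMap.mem_ker, sub_mul, ← Algebra.smul_def, map_sub, map_smul, heT,
        K.map_mul_of_map_eq_smul_one hgen4 (K.map_trace hq), sub_self]
    · rw [SetLike.mem_coe, LinearMap.mem_ker, sub_mul, ← Algebra.smul_def, map_sub, map_smul, heD,
        K.map_mul_of_map_eq_smul_one hgen4 (K.map_det hq), sub_self]
  have hJmul : ∀ j ∈ J, ∀ m, j * m ∈ J := by
    intro j hj m
    induction hj using Submodule.span_induction with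
    | mem y hy =>
      obtain ⟨h, hy⟩ := hy
      exact Submodule.subset_span ⟨h * m,
        hy.imp (by rintro rfl; rw [mul_assoc]) (by rintro rfl; rw [mul_assoc])⟩
    | zero => simp
    | add y z _ _ hy hz => rw [add_mul]; exact J.add_mem hy hz
    | smul r y _ hy => rw [smul_mul_assoc]; exact J.smul_mem r hy
  have htop := H.sup_span_eq_top hq hgen4 (t := q ^ 4 * e T) (s := e D) hJmul (fun m => by
    convert J.smul_mem (q ^ 4) (hJT m) using 1
    rw [hT, add_mul, smul_mul_assoc, smul_mul_assoc, smul_sub, smul_add, smul_smul, smul_smul,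
      smul_smul, mul_inv_cancel₀ (pow_ne_zero 4 hq), one_smul,
      show q ^ 4 * (q ^ 2)⁻¹ = q ^ 2 by field_simp, add_comm]) hJD
  refine ker_eq_of_sup_span_eq_top hJker htop ?_
  refine linearIndependent_of_rep hq ρ (a := ι a) (b := ι b) (c := ι c) (d := ι d)
    (z := dInv * (ι b * ι c)) (u := dInv) ?_ ?_ ?_ ?_ ?_ hρu _
    (fun n k => K.exists_pow_A_mul_pow_B hq hsep n k)
    (fun n k => K.exists_pow_A_mul_pow_C hq hsep (n + 1) k)
  all_goals simp [hρι, hρu, hφ, ha, hb, hc, hd]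
end
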